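/- Fix an integer d ≥ 1, let j_d(k) = #{(k_1,…,k_d) ∈ ℤ^d : k_1² + ⋯ + k_d² = k}, and set A(x) = (d/2)|log(1-x)| + ((d-2)/2)·log|log(1-x)| + (d/2)·log(d/2) + log(π^{d/2}/Γ(d/2+1)). Then for every real t, ∏_{k ∈ ℕ, k > (A(x)+t)/(1-x)} (1+x^k)^{-j_d(k)} → exp(-e^{-t}) as x → 1⁻. -/

import Mathlib

open Filter Topology

open MeasureTheory

theorem unit_cube_volume {d : ℕ} (v : Fin d → ℤ) :
    volume {y : EuclideanSpace ℝ (Fin d) | ∀ i, y i ∈ Set.Ico (v i : ℝ) (v i + 1)} = 1 := by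
  have h := (PiLp.volume_preserving_ofLp (Fin d)).measure_preimage
    (s := Set.pi Set.univ fun i => Set.Ico (v i : ℝ) (v i + 1))
    (MeasurableSet.univ_pi fun i => measurableSet_Ico).nullMeasurableSet
  rw [Real.volume_pi_Ico] at h
  simpa [Set.preimage, Set.mem_pi] using h

theorem measurableSet_unit_cube {d : ℕ} (v : Fin d → ℤ) :
    MeasurableSet {y : EuclideanSpace ℝ (Fin d) | ∀ i, y i ∈ Set.Ico (v i : ℝ) (v i + 1)} := by
  simp only [Set.ofPred_forall]
  exact MeasurableSet.iInter fun i => measurableSet_Ico.preimage (by fun_prop)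

theorem volume_biUnion_unit_cube {d : ℕ} (T : Finset (Fin d → ℤ)) :
    volume (⋃ v ∈ T, {y : EuclideanSpace ℝ (Fin d) | ∀ i, y i ∈ Set.Ico (v i : ℝ) (v i + 1)})
      = T.card := by
  rw [measure_biUnion_finset _ fun v _ => measurableSet_unit_cube v]
  · rw [Finset.sum_congr rfl fun v _ => unit_cube_volume v]; simp
  · intro v _ w _ hvw
    refine Set.disjoint_left.2 fun y hv hw => hvw ?_
    ext i
    have h1 := Int.floor_eq_iff.2 (hv i)
    have h2 := Int.floor_eq_iff.2 (hw i)
    rw [← h1, h2]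

theorem dist_le_sqrt_of_mem_unit_cube {d : ℕ} {v : Fin d → ℤ} {y : EuclideanSpace ℝ (Fin d)}
    (hy : ∀ i, y i ∈ Set.Ico (v i : ℝ) (v i + 1)) :
    ‖y - WithLp.toLp 2 (fun i => (v i : ℝ))‖ ≤ √d := by
  rw [EuclideanSpace.norm_eq]
  apply Real.sqrt_le_sqrt
  calc ∑ i, ‖(y - WithLp.toLp 2 (fun i => (v i : ℝ))) i‖ ^ 2 ≤ ∑ i : Fin d, (1 : ℝ) := by
        refine Finset.sum_le_sum fun i _ => ?_
        have := hy i
        simp only [PiLp.sub_apply, Real.norm_eq_abs, sq_abs]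
        nlinarith [this.1, this.2]
    _ = d := by simp

theorem card_le_and_le_card_of_mem_iff_norm_le {d : ℕ} (hd : 1 ≤ d) {ρ : ℝ} (hρ : 0 ≤ ρ)
    (T : Finset (Fin d → ℤ)) (hT : ∀ v, v ∈ T ↔ ∑ i, (v i : ℝ) ^ 2 ≤ ρ ^ 2) :
    (T.card : ℝ) ≤ (ρ + √d) ^ d * (√Real.pi ^ d / Real.Gamma (d / 2 + 1)) ∧
    (√d ≤ ρ → (ρ - √d) ^ d * (√Real.pi ^ d / Real.Gamma (d / 2 + 1)) ≤ T.card) := by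
  have hne : Nonempty (Fin d) := ⟨⟨0, hd⟩⟩
  have hT' : ∀ v, v ∈ T ↔ ‖(WithLp.toLp 2 (fun i => (v i : ℝ)) : EuclideanSpace ℝ (Fin d))‖ ≤ ρ := by
    intro v
    rw [hT, EuclideanSpace.norm_eq, Real.sqrt_le_left hρ]
    simp
  have hΓ : 0 ≤ √Real.pi ^ d / Real.Gamma ((d : ℝ) / 2 + 1) :=
    div_nonneg (by positivity) (Real.Gamma_pos_of_pos (by positivity)).le
  have hvol : ∀ r : ℝ, 0 ≤ r → volume (Metric.closedBall (0 : EuclideanSpace ℝ (Fin d)) r) =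
      ENNReal.ofReal (r ^ d * (√Real.pi ^ d / Real.Gamma (d / 2 + 1))) := by
    intro r hr
    rw [EuclideanSpace.volume_closedBall, ENNReal.ofReal_mul (by positivity),
      ENNReal.ofReal_pow hr]
    simp
  have hcard : ((T.card : ℕ) : ENNReal) = ENNReal.ofReal T.card := by simp
  constructor
  · have hsub : (⋃ v ∈ T, {y : EuclideanSpace ℝ (Fin d) | ∀ i, y i ∈ Set.Ico (v i : ℝ) (v i + 1)})
        ⊆ Metric.closedBall 0 (ρ + √d) := by
      refine Set.iUnion₂_subset fun v hv y hy => ?_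
      rw [mem_closedBall_zero_iff]
      have h1 := dist_le_sqrt_of_mem_unit_cube hy
      have h2 := (hT' v).1 hv
      have h3 := norm_le_norm_add_norm_sub' y (WithLp.toLp 2 (fun i => (v i : ℝ)))
      linarith
    have h := measure_mono (μ := volume) hsub
    rw [volume_biUnion_unit_cube, hvol _ (by positivity), hcard] at h
    exact (ENNReal.ofReal_le_ofReal_iff (by positivity)).1 h
  · intro hρd
    have hsub : Metric.closedBall 0 (ρ - √d) ⊆
        ⋃ v ∈ T, {y : EuclideanSpace ℝ (Fin d) | ∀ i, y i ∈ Set.Ico (v i : ℝ) (v i + 1)} := by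
      intro y hy
      rw [mem_closedBall_zero_iff] at hy
      have hy' : ∀ i, y i ∈ Set.Ico ((⌊y i⌋ : ℤ) : ℝ) (⌊y i⌋ + 1) := fun i =>
        ⟨Int.floor_le _, Int.lt_floor_add_one _⟩
      refine Set.mem_iUnion₂.2 ⟨fun i => ⌊y i⌋, (hT' _).2 ?_, hy'⟩
      have h1 := dist_le_sqrt_of_mem_unit_cube hy'
      have h3 := norm_le_norm_add_norm_sub y (WithLp.toLp 2 (fun i => ((⌊y i⌋ : ℤ) : ℝ)))
      linarith
    have h := measure_mono (μ := volume) hsub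
    rw [volume_biUnion_unit_cube, hvol _ (by linarith), hcard] at h
    exact (ENNReal.ofReal_le_ofReal_iff (by positivity)).1 h

theorem exists_abs_card_sub_le {d : ℕ} (hd : 1 ≤ d) :
    ∃ C : ℝ, 0 ≤ C ∧ ∀ ρ : ℝ, 1 ≤ ρ → ∀ T : Finset (Fin d → ℤ),
      (∀ v, v ∈ T ↔ ∑ i, (v i : ℝ) ^ 2 ≤ ρ ^ 2) →
      |(T.card : ℝ) - √Real.pi ^ d / Real.Gamma (d / 2 + 1) * ρ ^ d| ≤ C * ρ ^ (d - 1) := by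
  set c := √Real.pi ^ d / Real.Gamma ((d : ℝ) / 2 + 1) with hc
  have hc0 : 0 ≤ c := div_nonneg (by positivity) (Real.Gamma_pos_of_pos (by positivity)).le
  refine ⟨c * (√d * d * (1 + √d) ^ (d - 1)), by positivity, fun ρ hρ T hT => ?_⟩
  obtain ⟨h1, h2⟩ := card_le_and_le_card_of_mem_iff_norm_le hd (by linarith) T hT
  rw [← hc] at h1 h2
  have hd0 : (0 : ℝ) ≤ √d := Real.sqrt_nonneg _
  have hρ0 : 0 < ρ := by linarith
  have hρm : 0 ≤ ρ ^ (d - 1) := by positivity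
  have hd1 : (1 : ℝ) ≤ d := by exact_mod_cast hd
  have h1d : (1 : ℝ) ≤ (1 + √d) ^ (d - 1) := one_le_pow₀ (by linarith)
  rw [abs_le]
  constructor
  · have key : ρ ^ d * c - √d * d * ρ ^ (d - 1) * c ≤ T.card := by
      rcases le_total √d ρ with h | h
      · refine le_trans ?_ (h2 h)
        have h3 := abs_pow_sub_pow_le ρ (ρ - √d) d
        rw [sub_sub_cancel, abs_of_nonneg hd0, abs_of_pos hρ0, abs_of_nonneg (sub_nonneg.2 h),
          max_eq_left (by linarith)] at h3
        rw [← sub_mul]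
        exact mul_le_mul_of_nonneg_right (by linarith [le_abs_self (ρ ^ d - (ρ - √d) ^ d)]) hc0
      · refine le_trans ?_ (Nat.cast_nonneg _)
        rw [← sub_mul]
        refine mul_nonpos_of_nonpos_of_nonneg ?_ hc0
        rw [← mul_pow_sub_one (by omega : d ≠ 0) ρ, ← sub_mul]
        refine mul_nonpos_of_nonpos_of_nonneg ?_ hρm
        nlinarith
    have : √d * d * ρ ^ (d - 1) * c * 1 ≤ √d * d * ρ ^ (d - 1) * c * (1 + √d) ^ (d - 1) :=
      mul_le_mul_of_nonneg_left h1d (by positivity)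
    linarith
  · have h3 := abs_pow_sub_pow_le (ρ + √d) ρ d
    rw [add_sub_cancel_left, abs_of_nonneg hd0, abs_of_pos hρ0,
      abs_of_nonneg (by linarith : 0 ≤ ρ + √d), max_eq_left (by linarith)] at h3
    have h4 : (ρ + √d) ^ (d - 1) ≤ (1 + √d) ^ (d - 1) * ρ ^ (d - 1) := by
      rw [← mul_pow]
      exact pow_le_pow_left₀ (by linarith) (by nlinarith) _
    have h5 : √d * d * (ρ + √d) ^ (d - 1) ≤ √d * d * ((1 + √d) ^ (d - 1) * ρ ^ (d - 1)) :=
      mul_le_mul_of_nonneg_left h4 (by positivity)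
    have h6 := mul_le_mul_of_nonneg_left
      ((le_abs_self _).trans (h3.trans h5)) hc0
    linarith

theorem setIntegral_exp_neg_indicator_Ici {c : ℝ} (hc : 0 < c) :
    ∫ u in Set.Ioi (0 : ℝ), (Set.Ici c).indicator (fun u => Real.exp (-u)) u = Real.exp (-c) := by
  rw [setIntegral_indicator measurableSet_Ici, Set.inter_eq_right.2 (Set.Ici_subset_Ioi.2 hc),
    integral_Ici_eq_integral_Ioi, integral_exp_neg_Ioi]

theorem tsum_mul_exp_eq_integral_sum {a : ℕ → ℝ} (ha : ∀ k, 0 ≤ a k) {s M : ℝ} (hs : 0 < s)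
    (hM : 0 ≤ M) (hsum : Summable fun k => a k * Real.exp (-(s * k))) :
    ∑' k : ℕ, (if M < k then a k * Real.exp (-(s * (k - M))) else 0) =
      ∫ u in Set.Ioi (0 : ℝ), Real.exp (-u) * ∑ k ∈ Finset.Ioc ⌊M⌋₊ ⌊M + u / s⌋₊, a k := by
  set F : ℕ → ℝ → ℝ := fun k u =>
    if M < k then a k * (Set.Ici (s * (k - M))).indicator (fun u => Real.exp (-u)) u else 0 with hF
  have hF0 : ∀ k u, 0 ≤ F k u := by
    intro k u
    simp only [hF]
    split_ifs
    · exact mul_nonneg (ha k) (Set.indicator_nonneg (fun _ _ => (Real.exp_pos _).le) _)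
    · rfl
  have hint : ∀ k, Integrable (F k) (volume.restrict (Set.Ioi 0)) := by
    intro k
    simp only [hF]
    split_ifs
    · have h : IntegrableOn (fun u : ℝ => Real.exp (-u)) (Set.Ioi 0) := by
        simpa using exp_neg_integrableOn_Ioi 0 one_pos
      exact (h.integrable.indicator measurableSet_Ici).const_mul _
    · exact integrable_zero _ _ _
  have hval : ∀ k, ∫ u in Set.Ioi (0 : ℝ), F k u =
      if M < k then a k * Real.exp (-(s * (k - M))) else 0 := by
    intro k
    simp only [hF]
    split_ifs with h
    · rw [integral_const_mul, setIntegral_exp_neg_indicator_Ici (mul_pos hs (sub_pos.2 h))]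
    · simp
  have hsum' : Summable fun k : ℕ => if M < k then a k * Real.exp (-(s * (k - M))) else 0 := by
    refine Summable.of_nonneg_of_le (fun k => ?_) (fun k => ?_) (hsum.mul_right (Real.exp (s * M)))
    · split_ifs
      · exact mul_nonneg (ha k) (Real.exp_pos _).le
      · rfl
    · split_ifs
      · rw [mul_assoc, ← Real.exp_add]
        exact le_of_eq (by ring_nf)
      · exact mul_nonneg (mul_nonneg (ha k) (Real.exp_pos _).le) (Real.exp_pos _).le
  have h := integral_tsum_of_summable_integral_norm hint
    (by simpa only [Real.norm_of_nonneg (hF0 _ _), hval] using hsum')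
  simp only [hval] at h
  rw [h]
  refine setIntegral_congr_fun measurableSet_Ioi fun u hu => ?_
  have hu0 : (0 : ℝ) < u := hu
  have hmem : ∀ k : ℕ, k ∈ Finset.Ioc ⌊M⌋₊ ⌊M + u / s⌋₊ ↔ M < k ∧ s * (k - M) ≤ u := by
    intro k
    rw [Finset.mem_Ioc, Nat.floor_lt hM, Nat.le_floor_iff (by positivity), ← sub_le_iff_le_add',
      le_div_iff₀' hs]
  rw [tsum_eq_sum (s := Finset.Ioc ⌊M⌋₊ ⌊M + u / s⌋₊), Finset.mul_sum]
  · refine Finset.sum_congr rfl fun k hk => ?_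
    obtain ⟨h1, h2⟩ := (hmem k).1 hk
    simp [hF, h1, Set.indicator_of_mem (show u ∈ Set.Ici (s * ((k : ℝ) - M)) from h2), mul_comm]
  · intro k hk
    simp only [hF]
    split_ifs with h1
    · rw [Set.indicator_of_notMem, mul_zero]
      exact fun h2 => hk ((hmem k).2 ⟨h1, h2⟩)
    · rfl

theorem sqrt_pow_eq_exp {z : ℝ} (hz : 0 < z) (d : ℕ) :
    √z ^ d = Real.exp ((d : ℝ) / 2 * Real.log z) := by
  rw [← Real.exp_log (Real.sqrt_pos.2 hz), ← Real.exp_nat_mul, Real.log_sqrt hz.le]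
  ring_nf

theorem integrableOn_exp_neg_mul_add_pow {D : ℝ} (hD : 0 ≤ D) (n : ℕ) :
    IntegrableOn (fun u : ℝ => Real.exp (-u) * (D + u) ^ n) (Set.Ioi 0) := by
  have hi : IntegrableOn (fun u : ℝ => 2 ^ n * n.factorial * Real.exp (D / 2) *
      Real.exp (-(1 / 2) * u)) (Set.Ioi 0) :=
    (exp_neg_integrableOn_Ioi 0 (by norm_num)).const_mul _
  refine Integrable.mono' hi (by fun_prop) ?_
  refine (ae_restrict_iff' measurableSet_Ioi).2 (Eventually.of_forall fun u hu => ?_)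
  have hu0 : (0 : ℝ) < u := hu
  rw [Real.norm_of_nonneg (by positivity)]
  have h := Real.pow_div_factorial_le_exp ((D + u) / 2) (by positivity) n
  rw [div_le_iff₀ (by positivity), div_pow, div_le_iff₀ (by positivity)] at h
  calc Real.exp (-u) * (D + u) ^ n
      ≤ Real.exp (-u) * (Real.exp ((D + u) / 2) * n.factorial * 2 ^ n) := by gcongr
    _ = 2 ^ n * n.factorial * (Real.exp (-u) * Real.exp ((D + u) / 2)) := by ring
    _ = 2 ^ n * n.factorial * (Real.exp (D / 2) * Real.exp (-(1 / 2) * u)) := by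
        rw [← Real.exp_add, ← Real.exp_add]; ring_nf
    _ = _ := by ring

theorem mul_sqrt_pow_sub_sqrt_pow {L b v : ℝ} (hL : 0 < L) (hb : 0 < b) (hv : 0 ≤ v) (d : ℕ) :
    L * (√(b + v / L) ^ d - √b ^ d) =
      v * (∑ i ∈ Finset.range d, √(b + v / L) ^ i * √b ^ (d - 1 - i)) / (√(b + v / L) + √b) := by
  have hb' : 0 < √b := Real.sqrt_pos.2 hb
  have hpos : 0 < √(b + v / L) + √b := by positivity
  rw [eq_div_iff hpos.ne', ← geom_sum₂_mul]
  have h1 : √(b + v / L) ^ 2 = b + v / L := Real.sq_sqrt (by positivity)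
  have h2 : √b ^ 2 = b := Real.sq_sqrt hb.le
  have h3 : L * ((√(b + v / L) - √b) * (√(b + v / L) + √b)) = v := by
    rw [mul_comm (_ - _), ← sq_sub_sq, h1, h2]
    field_simp
    ring
  linear_combination (∑ i ∈ Finset.range d, √(b + v / L) ^ i * √b ^ (d - 1 - i)) * h3

theorem tendsto_mul_sqrt_pow_sub_sqrt_pow {ι : Type*} {l : Filter ι} {L b v : ι → ℝ} {q u : ℝ}
    (hL : Tendsto L l atTop) (hq : 0 < q) (hb : Tendsto b l (𝓝 q)) (hv : Tendsto v l (𝓝 u))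
    (hv0 : ∀ᶠ i in l, 0 ≤ v i) (d : ℕ) :
    Tendsto (fun i => L i * (√(b i + v i / L i) ^ d - √(b i) ^ d)) l
      (𝓝 (u * (d * √q ^ (d - 1)) / (√q + √q))) := by
  have hq' : 0 < √q := Real.sqrt_pos.2 hq
  have h0 : Tendsto (fun i => √(b i)) l (𝓝 √q) := hb.sqrt
  have h1 : Tendsto (fun i => √(b i + v i / L i)) l (𝓝 √q) := by
    simpa using (hb.add (hv.div_atTop hL)).sqrt
  have hsum : Tendsto (fun i => ∑ j ∈ Finset.range d,
      √(b i + v i / L i) ^ j * √(b i) ^ (d - 1 - j)) l (𝓝 (d * √q ^ (d - 1))) := by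
    have h := tendsto_finsetSum (Finset.range d) fun j (_ : j ∈ Finset.range d) =>
      (h1.pow j).mul (h0.pow (d - 1 - j))
    convert h using 2
    rw [Finset.sum_congr rfl (g := fun _ => √q ^ (d - 1))]
    · simp
    · intro j hj
      rw [← pow_add]
      congr 1
      have := Finset.mem_range.1 hj
      omega
  refine Tendsto.congr' ?_ ((hv.mul hsum).div (h1.add h0) (by positivity))
  filter_upwards [hL.eventually_gt_atTop 0, hb.eventually (lt_mem_nhds hq), hv0] with i hi hbi hvi
  exact (mul_sqrt_pow_sub_sqrt_pow hi hbi hvi d).symm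

/-- Increments of a counting function close to `c √r ^ d`, rescaled, are close to the increments
of `c √r ^ d`. -/
theorem abs_increment_sub_le {d : ℕ} (hd : 1 ≤ d) {N : ℝ → ℝ} {c C : ℝ} (hC : 0 ≤ C)
    (hN : ∀ r, 1 ≤ r → |N r - c * √r ^ d| ≤ C * √r ^ (d - 1)) {ε L b v : ℝ}
    (hε : 0 < ε) (hL : 0 < L) (hv : 0 ≤ v) (h1 : 1 ≤ b * L / ε) :
    |L * √(ε / L) ^ d * (N (b * L / ε + v / ε) - N (b * L / ε)) -
      c * (L * (√(b + v / L) ^ d - √b ^ d))| ≤ 2 * C * √(ε * L) * √(b + v / L) ^ (d - 1) := by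
  have hscale : ∀ w : ℝ, √(ε / L) * √(b * L / ε + w / ε) = √(b + w / L) := by
    intro w
    rw [← Real.sqrt_mul (by positivity)]
    congr 1
    field_simp
  have hb0 : √(ε / L) * √(b * L / ε) = √b := by simpa using hscale 0
  have hLs : L * √(ε / L) = √(ε * L) := by
    rw [← Real.sqrt_sq hL.le, ← Real.sqrt_mul (by positivity), Real.sqrt_sq hL.le]
    congr 1
    field_simp
  have hvε : 0 ≤ v / ε := by positivity
  have hmono : √b ≤ √(b + v / L) := Real.sqrt_le_sqrt (by linarith [div_nonneg hv hL.le])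
  have e1 := hN _ (h1.trans (by linarith : b * L / ε ≤ b * L / ε + v / ε))
  have e0 := hN _ h1
  have hpow : L * √(ε / L) ^ d = √(ε * L) * √(ε / L) ^ (d - 1) := by
    rw [← hLs, mul_assoc, mul_pow_sub_one (by omega)]
  have hw : 0 ≤ L * √(ε / L) ^ d := by positivity
  have key : L * √(ε / L) ^ d * (N (b * L / ε + v / ε) - N (b * L / ε)) -
      c * (L * (√(b + v / L) ^ d - √b ^ d)) =
      L * √(ε / L) ^ d * ((N (b * L / ε + v / ε) - c * √(b * L / ε + v / ε) ^ d) -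
        (N (b * L / ε) - c * √(b * L / ε) ^ d)) := by
    rw [← hscale v, ← hb0, mul_pow, mul_pow]
    ring
  rw [key, abs_mul, abs_of_nonneg hw]
  calc L * √(ε / L) ^ d * |_| ≤ L * √(ε / L) ^ d * (C * √(b * L / ε + v / ε) ^ (d - 1) +
        C * √(b * L / ε) ^ (d - 1)) :=
        mul_le_mul_of_nonneg_left ((abs_sub _ _).trans (add_le_add e1 e0)) hw
    _ = C * √(ε * L) * (√(b + v / L) ^ (d - 1) + √b ^ (d - 1)) := by
        rw [hpow, ← hscale v, ← hb0, mul_pow, mul_pow]; ring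
    _ ≤ C * √(ε * L) * (√(b + v / L) ^ (d - 1) + √(b + v / L) ^ (d - 1)) := by gcongr
    _ = _ := by ring

theorem abs_increment_le {d : ℕ} (hd : 1 ≤ d) {N : ℝ → ℝ} {c C : ℝ} (hc : 0 ≤ c) (hC : 0 ≤ C)
    (hN : ∀ r, 1 ≤ r → |N r - c * √r ^ d| ≤ C * √r ^ (d - 1)) {ε L b v : ℝ}
    (hε : 0 < ε) (hL : 1 ≤ L) (hv : 0 ≤ v) (h1 : 1 ≤ b * L / ε) (hεL : ε * L ≤ 1)
    (hb : 1 / 4 ≤ b) (hbd : b ≤ d + 1) :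
    |L * √(ε / L) ^ d * (N (b * L / ε + v / ε) - N (b * L / ε))| ≤
      (2 * c * d + 2 * C) * (d + 1 + v) ^ d := by
  have hL0 : 0 < L := by linarith
  set Y : ℝ := d + 1 + v with hY
  have hY1 : 1 ≤ Y := by linarith [Nat.cast_nonneg (α := ℝ) d]
  have hvL : v / L ≤ v := div_le_self hv hL
  have hyY : √(b + v / L) ≤ Y := by
    rw [Real.sqrt_le_left (by linarith)]
    nlinarith
  have hmono : √b ≤ √(b + v / L) := Real.sqrt_le_sqrt (by linarith [div_nonneg hv hL0.le])
  have hb2 : 1 / 2 ≤ √b := Real.le_sqrt_of_sq_le (by linarith)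
  have herr := abs_increment_sub_le hd hC hN hε hL0 hv h1
  have hs1 : √(ε * L) ≤ 1 := Real.sqrt_le_one.2 hεL
  have hYpow : Y ^ (d - 1) ≤ Y ^ d := pow_le_pow_right₀ hY1 (Nat.sub_le _ _)
  have herr2 : 2 * C * √(ε * L) * √(b + v / L) ^ (d - 1) ≤ 2 * C * Y ^ d := by
    calc 2 * C * √(ε * L) * √(b + v / L) ^ (d - 1) ≤ 2 * C * 1 * Y ^ (d - 1) := by gcongr
      _ ≤ 2 * C * Y ^ d := by rw [mul_one]; gcongr
  have hmain : L * (√(b + v / L) ^ d - √b ^ d) ≤ 2 * d * Y ^ d := by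
    have hsum : ∑ i ∈ Finset.range d, √(b + v / L) ^ i * √b ^ (d - 1 - i) ≤ d * Y ^ (d - 1) := by
      calc _ ≤ ∑ i ∈ Finset.range d, Y ^ (d - 1) := by
            refine Finset.sum_le_sum fun i hi => ?_
            have hid : d - 1 = i + (d - 1 - i) := by have := Finset.mem_range.1 hi; omega
            conv_rhs => rw [hid, pow_add]
            gcongr
            exact hmono.trans hyY
        _ = _ := by simp
    rw [mul_sqrt_pow_sub_sqrt_pow hL0 (by linarith) hv, div_le_iff₀ (by linarith)]
    calc _ ≤ v * (d * Y ^ (d - 1)) := by gcongr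
      _ ≤ Y * (d * Y ^ (d - 1)) := by gcongr; linarith [Nat.cast_nonneg (α := ℝ) d]
      _ = 2 * d * Y ^ d * (1 / 2) := by rw [← mul_pow_sub_one (by omega : d ≠ 0) Y]; ring
      _ ≤ _ := by gcongr; linarith
  have hmain0 : 0 ≤ L * (√(b + v / L) ^ d - √b ^ d) :=
    mul_nonneg hL0.le (sub_nonneg.2 (pow_le_pow_left₀ (Real.sqrt_nonneg _) hmono _))
  have hcm := mul_le_mul_of_nonneg_left hmain hc
  have hcm0 := mul_nonneg hc hmain0
  have h2 := abs_le.1 herr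
  rw [abs_le]
  have : 0 ≤ C * Y ^ d := by positivity
  constructor <;> nlinarith [h2.1, h2.2]

theorem tendsto_increment {ι : Type*} {l : Filter ι} {d : ℕ} (hd : 1 ≤ d) {N : ℝ → ℝ} {c C u : ℝ}
    (hC : 0 ≤ C) (hN : ∀ r, 1 ≤ r → |N r - c * √r ^ d| ≤ C * √r ^ (d - 1))
    {ε L b v : ι → ℝ} (hε : ∀ᶠ i in l, 0 < ε i) (hL : Tendsto L l atTop)
    (hεL : Tendsto (fun i => ε i * L i) l (𝓝 0)) (hb : Tendsto b l (𝓝 (d / 2)))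
    (hM : ∀ᶠ i in l, 1 ≤ b i * L i / ε i) (hv : Tendsto v l (𝓝 u)) (hv0 : ∀ᶠ i in l, 0 ≤ v i) :
    Tendsto (fun i => L i * √(ε i / L i) ^ d *
      (N (b i * L i / ε i + v i / ε i) - N (b i * L i / ε i))) l
      (𝓝 (u * (c * √((d : ℝ) / 2) ^ d))) := by
  have hd0 : (0 : ℝ) < d / 2 := by positivity
  have hmain := (tendsto_mul_sqrt_pow_sub_sqrt_pow hL hd0 hb hv hv0 d).const_mul c
  have herr : Tendsto (fun i => 2 * C * √(ε i * L i) * √(b i + v i / L i) ^ (d - 1)) l (𝓝 0) := by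
    have h := ((hεL.sqrt).const_mul (2 * C)).mul ((hb.add (hv.div_atTop hL)).sqrt.pow (d - 1))
    simpa using h
  have hdiff := squeeze_zero_norm' (a := fun i => 2 * C * √(ε i * L i) * √(b i + v i / L i) ^ (d - 1))
    (f := fun i => L i * √(ε i / L i) ^ d *
      (N (b i * L i / ε i + v i / ε i) - N (b i * L i / ε i)) -
      c * (L i * (√(b i + v i / L i) ^ d - √(b i) ^ d))) (t₀ := l) (by
      filter_upwards [hε, hL.eventually_gt_atTop 0, hv0, hM] with i h1 h2 h3 h4
      exact abs_increment_sub_le hd hC hN h1 h2 h3 h4) herr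
  have h := hdiff.add hmain
  simp only [sub_add_cancel, zero_add] at h
  convert h using 2
  have hq : 0 < √((d : ℝ) / 2) := Real.sqrt_pos.2 hd0
  have hq2 : √((d : ℝ) / 2) * √((d : ℝ) / 2) = d / 2 := Real.mul_self_sqrt hd0.le
  rw [← mul_pow_sub_one (by omega : d ≠ 0) (√((d : ℝ) / 2))]
  field_simp
  linear_combination (2 * c * u) * hq2

theorem tendsto_integral_increment {ι : Type*} {l : Filter ι} [l.IsCountablyGenerated] {d : ℕ}
    (hd : 1 ≤ d) {N : ℝ → ℝ} (hNm : Measurable N) {c C : ℝ} (hc : 0 ≤ c)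
    (hC : 0 ≤ C) (hN : ∀ r, 1 ≤ r → |N r - c * √r ^ d| ≤ C * √r ^ (d - 1))
    {ε s L b : ι → ℝ} (hε : ∀ᶠ i in l, 0 < ε i) (hεs : ∀ᶠ i in l, ε i ≤ s i)
    (hεs' : Tendsto (fun i => ε i / s i) l (𝓝 1)) (hL : Tendsto L l atTop)
    (hεL : Tendsto (fun i => ε i * L i) l (𝓝 0)) (hb : Tendsto b l (𝓝 (d / 2)))
    (hM : ∀ᶠ i in l, 1 ≤ b i * L i / ε i) :
    Tendsto (fun i => ∫ u in Set.Ioi (0 : ℝ), Real.exp (-u) * (L i * √(ε i / L i) ^ d *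
      (N (b i * L i / ε i + u / s i) - N (b i * L i / ε i)))) l
      (𝓝 (c * √((d : ℝ) / 2) ^ d)) := by
  have hd1 : (1 : ℝ) ≤ d := by exact_mod_cast hd
  have hlim : ∫ u in Set.Ioi (0 : ℝ), Real.exp (-u) * (u * (c * √((d : ℝ) / 2) ^ d)) =
      c * √((d : ℝ) / 2) ^ d := by
    have h := Real.Gamma_eq_integral (s := 2) (by norm_num)
    simp only [show (2 : ℝ) - 1 = 1 by norm_num, Real.rpow_one, Real.Gamma_two] at h
    simp only [← mul_assoc, integral_mul_const]
    rw [← h]; ring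
  rw [← hlim]
  have hrw : ∀ᶠ i in l, ∀ u : ℝ, u / s i = (u * (ε i / s i)) / ε i := by
    filter_upwards [hε, hεs] with i h1 h2 u
    have : s i ≠ 0 := by linarith
    field_simp
  refine tendsto_integral_filter_of_dominated_convergence
    (fun u => (2 * c * d + 2 * C) * (Real.exp (-u) * (d + 1 + u) ^ d)) ?_ ?_ ?_ ?_
  · refine Eventually.of_forall fun i => Measurable.aestronglyMeasurable ?_
    fun_prop
  · filter_upwards [hrw, hε, hεs, hL.eventually_ge_atTop 1, hM,
      hεL.eventually_le_const one_pos, hb.eventually_const_le (by linarith : (1 / 4 : ℝ) < d / 2),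
      hb.eventually_le_const (by linarith : (d / 2 : ℝ) < d + 1)] with i h1 h2 h3 h4 h5 h6 h7 h8
    refine (ae_restrict_iff' measurableSet_Ioi).2 (Eventually.of_forall fun u hu => ?_)
    have hu0 : (0 : ℝ) < u := hu
    have hθ : 0 ≤ ε i / s i := div_nonneg h2.le (by linarith)
    rw [norm_mul, Real.norm_of_nonneg (Real.exp_pos _).le, mul_left_comm, h1, Real.norm_eq_abs]
    refine mul_le_mul_of_nonneg_left ?_ (Real.exp_pos _).le
    refine (abs_increment_le hd hc hC hN h2 h4 (by positivity) h5 h6 h7 h8).trans ?_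
    have : u * (ε i / s i) ≤ u := mul_le_of_le_one_right hu0.le (div_le_one_of_le₀ h3 (by linarith))
    gcongr
  · exact (integrableOn_exp_neg_mul_add_pow (by positivity) d).const_mul _
  · refine (ae_restrict_iff' measurableSet_Ioi).2 (Eventually.of_forall fun u hu => ?_)
    have hu0 : (0 : ℝ) < u := hu
    refine Tendsto.const_mul _ ?_
    have hv : Tendsto (fun i => u * (ε i / s i)) l (𝓝 u) := by simpa using hεs'.const_mul u
    refine Tendsto.congr' ?_ (tendsto_increment hd hC hN hε hL hεL hb hM hv ?_)
    · filter_upwards [hrw] with i h1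
      rw [← h1 u]
    · filter_upwards [hε, hεs] with i h1 h2
      exact mul_nonneg hu0.le (div_nonneg h1.le (by linarith))

theorem exists_finset_sum_sq_le {d : ℕ} {j : ℕ → ℕ}
    (hj : ∀ k : ℕ, j k = Nat.card {v : Fin d → ℤ // ∑ i, (v i) ^ 2 = (k : ℤ)})
    {r : ℝ} (hr : 0 ≤ r) :
    ∃ T : Finset (Fin d → ℤ), (∀ v, v ∈ T ↔ ∑ i, (v i : ℝ) ^ 2 ≤ r) ∧
      T.card = ∑ k ∈ Finset.range (⌊r⌋₊ + 1), j k := by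
  set n := ⌊r⌋₊ with hn
  have hmem : ∀ v : Fin d → ℤ, ∑ i, v i ^ 2 ≤ (n : ℤ) →
      v ∈ Fintype.piFinset fun _ : Fin d => Finset.Icc (-(n : ℤ)) n := by
    intro v hv
    refine Fintype.mem_piFinset.2 fun i => Finset.mem_Icc.2 ?_
    have h1 : v i ^ 2 ≤ n :=
      (Finset.single_le_sum (f := fun i => v i ^ 2) (fun j _ => sq_nonneg _)
        (Finset.mem_univ i)).trans hv
    constructor <;> nlinarith
  refine ⟨(Fintype.piFinset fun _ : Fin d => Finset.Icc (-(n : ℤ)) n).filter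
    fun v => ∑ i, v i ^ 2 ≤ (n : ℤ), fun v => ?_, ?_⟩
  · rw [Finset.mem_filter, and_iff_right_of_imp (hmem v)]
    have h0 : 0 ≤ ∑ i, v i ^ 2 := Finset.sum_nonneg fun i _ => sq_nonneg _
    rw [hn, Int.natCast_floor_eq_floor hr, Int.le_floor]
    push_cast
    rfl
  · rw [Finset.card_eq_sum_card_fiberwise (f := fun v => (∑ i, v i ^ 2).toNat)
      (t := Finset.range (n + 1))]
    · refine Finset.sum_congr rfl fun k hk => ?_
      rw [hj, eq_comm]
      refine Nat.subtype_card _ fun v => ?_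
      have h0 : 0 ≤ ∑ i, v i ^ 2 := Finset.sum_nonneg fun i _ => sq_nonneg _
      have hk' := Finset.mem_range.1 hk
      rw [Finset.mem_filter, Finset.mem_filter]
      constructor
      · rintro ⟨-, h⟩
        omega
      · intro h
        have hle : ∑ i, v i ^ 2 ≤ (n : ℤ) := by omega
        exact ⟨⟨hmem v hle, hle⟩, by omega⟩
    · intro v hv
      have h := (Finset.mem_filter.1 hv).2
      simp only [Finset.coe_range, Set.mem_Iio]
      omega

theorem exists_abs_sum_card_sub_le {d : ℕ} (hd : 1 ≤ d) {j : ℕ → ℕ}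
    (hj : ∀ k : ℕ, j k = Nat.card {v : Fin d → ℤ // ∑ i, (v i) ^ 2 = (k : ℤ)}) :
    ∃ C : ℝ, 0 ≤ C ∧ ∀ r : ℝ, 1 ≤ r →
      |∑ k ∈ Finset.range (⌊r⌋₊ + 1), (j k : ℝ) - √Real.pi ^ d / Real.Gamma (d / 2 + 1) *
        √r ^ d| ≤ C * √r ^ (d - 1) := by
  obtain ⟨C, hC, h⟩ := exists_abs_card_sub_le hd
  refine ⟨C, hC, fun r hr => ?_⟩
  obtain ⟨T, hT, hcard⟩ := exists_finset_sum_sq_le hj (zero_le_one.trans hr)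
  have h' := h (√r) (Real.one_le_sqrt.2 hr) T (by rwa [Real.sq_sqrt (by linarith)])
  rwa [hcard, Nat.cast_sum] at h'

theorem summable_mul_pow_of_abs_sum_sub_le {d : ℕ} {a : ℕ → ℝ} (ha : ∀ k, 0 ≤ a k) {c C : ℝ}
    (hc : 0 ≤ c) (hC : 0 ≤ C) (hN : ∀ r : ℝ, 1 ≤ r →
      |∑ k ∈ Finset.range (⌊r⌋₊ + 1), a k - c * √r ^ d| ≤ C * √r ^ (d - 1))
    {x : ℝ} (hx0 : 0 ≤ x) (hx1 : x < 1) : Summable fun k => a k * x ^ k := by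
  have hx : ‖x‖ < 1 := by rwa [Real.norm_of_nonneg hx0]
  have hg : Summable fun k : ℕ => (c + C) * ((k : ℝ) ^ d * x ^ k) :=
    (summable_pow_mul_geometric_of_norm_lt_one d hx).mul_left (c + C)
  refine Summable.of_norm_bounded_eventually_nat hg ?_
  filter_upwards [eventually_ge_atTop 1] with k hk
  have hk1 : (1 : ℝ) ≤ k := by exact_mod_cast hk
  rw [Real.norm_of_nonneg (mul_nonneg (ha k) (by positivity)), ← mul_assoc]
  refine mul_le_mul_of_nonneg_right ?_ (by positivity)
  have h1 := (abs_le.1 (hN k hk1)).2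
  rw [Nat.floor_natCast] at h1
  have h2 : a k ≤ ∑ j ∈ Finset.range (k + 1), a j :=
    Finset.single_le_sum (fun j _ => ha j) (Finset.self_mem_range_succ k)
  have hs : √(k : ℝ) ≤ k := by rw [Real.sqrt_le_left (by positivity)]; nlinarith
  have h3 : c * √(k : ℝ) ^ d ≤ c * (k : ℝ) ^ d := by gcongr
  have h4 : C * √(k : ℝ) ^ (d - 1) ≤ C * (k : ℝ) ^ d := by
    refine mul_le_mul_of_nonneg_left ?_ hC
    exact (pow_le_pow_left₀ (Real.sqrt_nonneg _) hs _).trans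
      (pow_le_pow_right₀ hk1 (Nat.sub_le _ _))
  linarith

theorem tendsto_one_sub_nhdsLT_one : Tendsto (fun x : ℝ => 1 - x) (𝓝[<] 1) (𝓝[>] 0) := by
  refine tendsto_nhdsWithin_iff.2 ⟨?_, ?_⟩
  · have : Tendsto (fun x : ℝ => 1 - x) (𝓝 1) (𝓝 (1 - 1)) := by
      exact (continuous_const.sub continuous_id).tendsto 1
    rw [sub_self] at this
    exact this.mono_left nhdsWithin_le_nhds
  · filter_upwards [self_mem_nhdsWithin] with x hx
    exact sub_pos.2 (Set.mem_Iio.1 hx)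

theorem tendsto_neg_log_one_sub : Tendsto (fun x : ℝ => -Real.log (1 - x)) (𝓝[<] 1) atTop :=
  tendsto_neg_atBot_atTop.comp (Real.tendsto_log_nhdsGT_zero.comp tendsto_one_sub_nhdsLT_one)

theorem tendsto_one_sub_mul_neg_log :
    Tendsto (fun x : ℝ => (1 - x) * -Real.log (1 - x)) (𝓝[<] 1) (𝓝 0) := by
  have h := (Real.continuous_mul_log.neg.tendsto 0).comp
    (tendsto_one_sub_nhdsLT_one.mono_right nhdsWithin_le_nhds)
  simpa [Function.comp_def] using h

theorem tendsto_one_sub_div_neg_log :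
    Tendsto (fun x : ℝ => (1 - x) / -Real.log x) (𝓝[<] 1) (𝓝 1) := by
  have h := (Real.hasDerivAt_log one_ne_zero).tendsto_slope.mono_left
    (nhdsWithin_mono (1 : ℝ) (fun x (hx : x < 1) => hx.ne))
  have h2 := h.inv₀ (by norm_num)
  simp only [inv_one] at h2
  refine h2.congr fun x => ?_
  simp only [slope, vsub_eq_sub, Real.log_one, sub_zero, smul_eq_mul]
  rw [mul_inv, inv_inv, ← neg_sub x 1, neg_div_neg_eq, div_eq_mul_inv]

theorem tsum_ite_mul_pow_eq {a : ℕ → ℝ} (ha : ∀ k, 0 ≤ a k) {x M : ℝ} (hx0 : 0 < x) (hx1 : x < 1)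
    (hM : 0 ≤ M) (hsum : Summable fun k => a k * x ^ k) :
    ∑' k : ℕ, (if M < k then a k * x ^ k else 0) =
      Real.exp (-(-Real.log x * M)) * ∫ u in Set.Ioi (0 : ℝ), Real.exp (-u) *
        (∑ k ∈ Finset.range (⌊M + u / -Real.log x⌋₊ + 1), a k -
          ∑ k ∈ Finset.range (⌊M⌋₊ + 1), a k) := by
  have hs : 0 < -Real.log x := neg_pos.2 (Real.log_neg hx0 hx1)
  have hpow : ∀ k : ℕ, x ^ k = Real.exp (-(-Real.log x * k)) := by
    intro k
    rw [neg_mul, neg_neg, mul_comm, Real.exp_nat_mul, Real.exp_log hx0]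
  have h := tsum_mul_exp_eq_integral_sum ha hs hM (by simpa only [← hpow] using hsum)
  have hint : ∫ u in Set.Ioi (0 : ℝ), Real.exp (-u) *
        (∑ k ∈ Finset.range (⌊M + u / -Real.log x⌋₊ + 1), a k -
          ∑ k ∈ Finset.range (⌊M⌋₊ + 1), a k) =
      ∫ u in Set.Ioi (0 : ℝ), Real.exp (-u) *
        ∑ k ∈ Finset.Ioc ⌊M⌋₊ ⌊M + u / -Real.log x⌋₊, a k := by
    refine setIntegral_congr_fun measurableSet_Ioi fun u hu => ?_
    have hu0 : (0 : ℝ) < u := hu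
    have hle : ⌊M⌋₊ ≤ ⌊M + u / -Real.log x⌋₊ :=
      Nat.floor_le_floor (le_add_of_nonneg_right (by positivity))
    rw [← Finset.sum_Ico_eq_sub _ (by omega), ← Finset.Ico_add_one_add_one_eq_Ioc]
  rw [hint, ← h, ← tsum_mul_left]
  refine tsum_congr fun k => ?_
  split_ifs
  · rw [hpow, mul_left_comm, ← Real.exp_add]
    ring_nf
  · simp

/-- A centering `B x = b x * L` with `L = |log (1 - x)|` for which `exp (-B x)` is
`K L √((1 - x) / L) ^ d` turns the counting asymptotics into a limit of the tail sums. -/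
theorem tendsto_tsum_ite_mul_pow {d : ℕ} (hd : 1 ≤ d) {a : ℕ → ℝ} (ha : ∀ k, 0 ≤ a k) {c C : ℝ}
    (hc : 0 ≤ c) (hC : 0 ≤ C) (hN : ∀ r : ℝ, 1 ≤ r →
      |∑ k ∈ Finset.range (⌊r⌋₊ + 1), a k - c * √r ^ d| ≤ C * √r ^ (d - 1))
    {B : ℝ → ℝ} {K : ℝ} (hB : Tendsto (fun x => B x / -Real.log (1 - x)) (𝓝[<] 1) (𝓝 (d / 2)))
    (hBK : ∀ᶠ x in 𝓝[<] 1, Real.exp (-B x) =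
      K * (-Real.log (1 - x) * √((1 - x) / -Real.log (1 - x)) ^ d)) :
    Tendsto (fun x : ℝ => ∑' k : ℕ, if B x / (1 - x) < (k : ℝ) then a k * x ^ k else 0)
      (𝓝[<] 1) (𝓝 (K * (c * √((d : ℝ) / 2) ^ d))) := by
  set N : ℝ → ℝ := fun r => ∑ k ∈ Finset.range (⌊r⌋₊ + 1), a k with hNdef
  have hNm : Measurable N := by
    refine Monotone.measurable fun r r' h => ?_
    refine Finset.sum_le_sum_of_subset_of_nonneg
      (Finset.range_mono (Nat.add_le_add_right (Nat.floor_le_floor h) 1)) fun k _ _ => ha k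
  have hL := tendsto_neg_log_one_sub
  have hd0 : (0 : ℝ) < d / 2 := by positivity
  have hx1 : ∀ᶠ x : ℝ in 𝓝[<] 1, x < 1 := self_mem_nhdsWithin
  have hx0 : ∀ᶠ x : ℝ in 𝓝[<] 1, 1 / 2 < x := nhdsWithin_le_nhds (lt_mem_nhds (by norm_num))
  have hBL : ∀ᶠ x in 𝓝[<] 1, B x = B x / -Real.log (1 - x) * -Real.log (1 - x) := by
    filter_upwards [hL.eventually_gt_atTop 0] with x hx
    rw [div_mul_cancel₀ _ hx.ne']
  have hBtop : Tendsto B (𝓝[<] 1) atTop :=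
    (hB.pos_mul_atTop hd0 hL).congr' (hBL.mono fun x h => h.symm)
  have hM : ∀ᶠ x in 𝓝[<] 1,
      1 ≤ B x / -Real.log (1 - x) * -Real.log (1 - x) / (1 - x) := by
    filter_upwards [hBL, hBtop.eventually_ge_atTop 1, hx1, hx0] with x h1 h2 h3 h4
    rw [← h1, le_div_iff₀ (by linarith)]
    linarith
  have hlog : ∀ᶠ x : ℝ in 𝓝[<] 1, 1 - x ≤ -Real.log x := by
    filter_upwards [hx0] with x h
    linarith [Real.log_le_sub_one_of_pos (by linarith : 0 < x)]
  have hI := tendsto_integral_increment hd hNm hc hC hN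
    (hx1.mono fun x h => sub_pos.2 h) hlog tendsto_one_sub_div_neg_log hL
    tendsto_one_sub_mul_neg_log hB hM
  have herr : Tendsto (fun x => B x * (-Real.log x / (1 - x) - 1)) (𝓝[<] 1) (𝓝 0) := by
    have hup : Tendsto (fun x => B x / -Real.log (1 - x) * ((1 - x) * -Real.log (1 - x)) * 2)
        (𝓝[<] 1) (𝓝 0) := by
      simpa using (hB.mul tendsto_one_sub_mul_neg_log).mul_const 2
    refine squeeze_zero' ?_ ?_ hup
    · filter_upwards [hlog, hx1, hBtop.eventually_ge_atTop 0] with x h1 h2 h3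
      refine mul_nonneg h3 (sub_nonneg.2 ?_)
      rwa [one_le_div (sub_pos.2 h2)]
    · filter_upwards [hBL, hx1, hx0, hBtop.eventually_ge_atTop 0] with x h1 h2 h3 h4
      rw [mul_comm (1 - x), ← mul_assoc, ← h1, mul_assoc]
      refine mul_le_mul_of_nonneg_left ?_ h4
      have hx : 0 < x := by linarith
      have h5 := Real.one_sub_inv_le_log_of_pos hx
      rw [sub_le_iff_le_add, div_le_iff₀ (sub_pos.2 h2)]
      have h6 : x⁻¹ * x = 1 := inv_mul_cancel₀ hx.ne'
      have h7 : x⁻¹ ≤ 2 := by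
        rw [inv_le_comm₀ hx two_pos]; linarith
      nlinarith [mul_nonneg (mul_nonneg (sub_nonneg.2 h2.le) (sub_nonneg.2 h2.le))
        (sub_nonneg.2 h7)]
  have hfin := ((Real.continuous_exp.tendsto _).comp herr.neg).mul (hI.const_mul K)
  simp only [neg_zero, Real.exp_zero, one_mul] at hfin
  refine hfin.congr' ?_
  filter_upwards [hBK, hBL, hx1, hx0, hM] with x h1 h2 h3 h4 h5
  rw [← h2] at h5 ⊢
  rw [tsum_ite_mul_pow_eq ha (by linarith) h3 (by linarith)
    (summable_mul_pow_of_abs_sum_sub_le ha hc hC hN (by linarith) h3)]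
  have h6 : Real.exp (-(-Real.log x * (B x / (1 - x)))) =
      Real.exp (-(B x * (-Real.log x / (1 - x) - 1))) * Real.exp (-B x) := by
    rw [← Real.exp_add]; ring_nf
  rw [h6, h1]
  simp only [Function.comp_def, mul_left_comm (Real.exp (-_)) (_ * _) (_ - _), integral_const_mul]
  simp only [hNdef, mul_assoc]

theorem tprod_ite_one_add_pow_rpow_neg {a : ℕ → ℝ} (ha : ∀ k, 0 ≤ a k) {x M : ℝ} (hx0 : 0 < x)
    (hsum : Summable fun k => a k * x ^ k) :
    ∏' k : ℕ, (if M < k then (1 + x ^ k) ^ (-a k) else 1) =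
      Real.exp (-∑' k : ℕ, if M < k then a k * Real.log (1 + x ^ k) else 0) := by
  have hs : Summable fun k : ℕ => if M < k then a k * Real.log (1 + x ^ k) else 0 := by
    refine Summable.of_nonneg_of_le (fun k => ?_) (fun k => ?_) hsum
    · split_ifs
      · exact mul_nonneg (ha k) (Real.log_nonneg (by linarith [pow_pos hx0 k]))
      · rfl
    · have hk := pow_pos hx0 k
      split_ifs
      · refine mul_le_mul_of_nonneg_left ?_ (ha k)
        linarith [Real.log_le_sub_one_of_pos (by linarith : 0 < 1 + x ^ k)]
      · exact mul_nonneg (ha k) hk.le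
  rw [← hs.hasSum.neg.rexp.tprod_eq]
  refine tprod_congr fun k => ?_
  have hk := pow_pos hx0 k
  simp only [Function.comp_apply]
  split_ifs
  · rw [Real.rpow_def_of_pos (by linarith)]
    ring_nf
  · simp

/-- Beyond `M`, replacing `log (1 + x ^ k)` by its first-order term `x ^ k` costs at most the
factor `1 + x ^ M`. -/
theorem tsum_ite_mul_log_bounds {a : ℕ → ℝ} (ha : ∀ k, 0 ≤ a k) {x M : ℝ} (hx0 : 0 < x)
    (hx1 : x < 1) (hsum : Summable fun k => a k * x ^ k) :
    (1 + x ^ M)⁻¹ * ∑' k : ℕ, (if M < k then a k * x ^ k else 0) ≤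
        ∑' k : ℕ, (if M < k then a k * Real.log (1 + x ^ k) else 0) ∧
      ∑' k : ℕ, (if M < k then a k * Real.log (1 + x ^ k) else 0) ≤
        ∑' k : ℕ, (if M < k then a k * x ^ k else 0) := by
  have hle : ∀ k : ℕ, Real.log (1 + x ^ k) ≤ x ^ k := fun k => by
    linarith [Real.log_le_sub_one_of_pos (by linarith [pow_pos hx0 k] : 0 < 1 + x ^ k)]
  have hs1 : Summable fun k : ℕ => if M < k then a k * x ^ k else 0 := by
    refine Summable.of_nonneg_of_le (fun k => ?_) (fun k => ?_) hsum
    all_goals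
      have h := mul_nonneg (ha k) (pow_pos hx0 k).le
      split_ifs <;> simp [h]
  have hle' : ∀ k : ℕ, (if M < k then a k * Real.log (1 + x ^ k) else 0) ≤
      if M < k then a k * x ^ k else 0 := by
    intro k
    split_ifs
    · exact mul_le_mul_of_nonneg_left (hle k) (ha k)
    · rfl
  have hs2 : Summable fun k : ℕ => if M < k then a k * Real.log (1 + x ^ k) else 0 := by
    refine Summable.of_nonneg_of_le (fun k => ?_) hle' hs1
    split_ifs
    · exact mul_nonneg (ha k) (Real.log_nonneg (by linarith [pow_pos hx0 k]))
    · rfl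
  refine ⟨?_, hs2.tsum_le_tsum hle' hs1⟩
  rw [← tsum_mul_left]
  refine (hs1.mul_left _).tsum_le_tsum (fun k => ?_) hs2
  split_ifs with h
  · have hk := pow_pos hx0 k
    have hM : x ^ (k : ℕ) ≤ x ^ M := by
      rw [← Real.rpow_natCast]
      exact Real.rpow_le_rpow_of_exponent_ge hx0 hx1.le h.le
    have h1 := Real.one_sub_inv_le_log_of_pos (by linarith : 0 < 1 + x ^ k)
    have h2 : (1 + x ^ M)⁻¹ ≤ (1 + x ^ k)⁻¹ := by gcongr
    have h3 : (1 + x ^ k)⁻¹ * x ^ k = 1 - (1 + x ^ k)⁻¹ := by field_simp; ring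
    rw [mul_left_comm]
    refine mul_le_mul_of_nonneg_left ?_ (ha k)
    calc (1 + x ^ M)⁻¹ * x ^ k ≤ (1 + x ^ k)⁻¹ * x ^ k := by gcongr
      _ ≤ _ := by rwa [h3]
  · simp

theorem tendsto_rpow_div_one_sub {B : ℝ → ℝ} (hB : Tendsto B (𝓝[<] 1) atTop) :
    Tendsto (fun x => x ^ (B x / (1 - x))) (𝓝[<] 1) (𝓝 0) := by
  refine squeeze_zero' ?_ ?_ (Real.tendsto_exp_neg_atTop_nhds_zero.comp hB)
  · filter_upwards [nhdsWithin_le_nhds (lt_mem_nhds one_pos)] with x hx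
    exact Real.rpow_nonneg (le_of_lt hx) _
  · filter_upwards [nhdsWithin_le_nhds (lt_mem_nhds one_pos), self_mem_nhdsWithin,
      hB.eventually_ge_atTop 0] with x hx hx1 hB0
    have h1 : 0 < 1 - x := sub_pos.2 (Set.mem_Iio.1 hx1)
    have hx' : 0 < x := hx
    rw [Function.comp_apply, Real.rpow_def_of_pos hx', Real.exp_le_exp, mul_div_assoc', div_le_iff₀ h1]
    nlinarith [Real.log_le_sub_one_of_pos hx']

theorem exp_neg_centering_eq {d : ℕ} {c ε t : ℝ} (hc : 0 < c) (hd : 1 ≤ d) (hε : 0 < ε)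
    (hL : 0 < -Real.log ε) :
    Real.exp (-((d : ℝ) / 2 * -Real.log ε + ((d : ℝ) - 2) / 2 * Real.log (-Real.log ε) +
      (d : ℝ) / 2 * Real.log ((d : ℝ) / 2) + Real.log c + t)) =
    Real.exp (-t) / (c * √((d : ℝ) / 2) ^ d) *
      (-Real.log ε * √(ε / -Real.log ε) ^ d) := by
  have hd0 : (0 : ℝ) < d / 2 := by positivity
  rw [sqrt_pow_eq_exp hd0, sqrt_pow_eq_exp (div_pos hε hL), Real.log_div hε.ne' hL.ne']
  have h1 : c = Real.exp (Real.log c) := (Real.exp_log hc).symm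
  have h2 : -Real.log ε = Real.exp (Real.log (-Real.log ε)) := (Real.exp_log hL).symm
  calc _ = Real.exp (-t) / (Real.exp (Real.log c) *
        Real.exp ((d : ℝ) / 2 * Real.log ((d : ℝ) / 2))) * (Real.exp (Real.log (-Real.log ε)) *
          Real.exp ((d : ℝ) / 2 * (Real.log ε - Real.log (-Real.log ε)))) := by
        rw [← Real.exp_add, ← Real.exp_sub, ← Real.exp_add, ← Real.exp_add]
        ring_nf
    _ = _ := by rw [← h1, ← h2]

theorem tendsto_centering_div {d : ℕ} (κ : ℝ) :
    Tendsto (fun L : ℝ => ((d : ℝ) / 2 * L + ((d : ℝ) - 2) / 2 * Real.log L + κ) / L) atTop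
      (𝓝 (d / 2)) := by
  have h1 : Tendsto (fun L : ℝ => Real.log L / L) atTop (𝓝 0) :=
    Real.isLittleO_log_id_atTop.tendsto_div_nhds_zero
  have h2 : Tendsto (fun L : ℝ => κ / L) atTop (𝓝 0) := tendsto_const_nhds.div_atTop tendsto_id
  have h := ((h1.const_mul (((d : ℝ) - 2) / 2)).const_add ((d : ℝ) / 2)).add h2
  simp only [mul_zero, add_zero] at h
  refine h.congr' ?_
  filter_upwards [eventually_gt_atTop 0] with L hL
  field_simp

/-- **Fermi–Dirac analogue of Theorem 2.** For the multiplicative statistics of the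
`d`-dimensional ideal Fermi gas, with `f_k(z) = (1+z)^{j_d(k)}`, the probability
`∏_{k > (A(x)+t)/(1-x)} (1+x^k)^{-j_d(k)}` that the maximal particle energy,
rescaled, is at most `t` tends to the Gumbel distribution function
`exp (-exp (-t))` as `x → 1⁻`, with the same centering `A(x)` as for the Bose gas. -/
theorem stmt_14 (d : ℕ) (hd : 1 ≤ d)
    (jd : ℕ → ℕ)
    (hjd : ∀ k : ℕ, jd k = Nat.card {v : Fin d → ℤ // ∑ i, (v i) ^ 2 = (k : ℤ)})
    (A : ℝ → ℝ)
    (hA : ∀ x : ℝ, A x = ((d : ℝ) / 2) * |Real.log (1 - x)|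
      + (((d : ℝ) - 2) / 2) * Real.log |Real.log (1 - x)|
      + ((d : ℝ) / 2) * Real.log ((d : ℝ) / 2)
      + Real.log (Real.pi ^ ((d : ℝ) / 2) / Real.Gamma ((d : ℝ) / 2 + 1)))
    (t : ℝ) :
    Tendsto (fun x : ℝ => ∏' k : ℕ,
        if (A x + t) / (1 - x) < (k : ℝ) then (1 + x ^ k) ^ (-(jd k : ℝ)) else 1)
      (𝓝[<] (1 : ℝ)) (𝓝 (Real.exp (-Real.exp (-t)))) := by
  have hd0 : (0 : ℝ) < d / 2 := by positivity
  set c : ℝ := √Real.pi ^ d / Real.Gamma ((d : ℝ) / 2 + 1) with hc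
  have hc0 : 0 < c := div_pos (by positivity) (Real.Gamma_pos_of_pos (by positivity))
  have hcpi : Real.pi ^ ((d : ℝ) / 2) / Real.Gamma ((d : ℝ) / 2 + 1) = c := by
    rw [hc, sqrt_pow_eq_exp Real.pi_pos, Real.rpow_def_of_pos Real.pi_pos, mul_comm]
  obtain ⟨C, hC, hN⟩ := exists_abs_sum_card_sub_le hd hjd
  have hx1 : ∀ᶠ x : ℝ in 𝓝[<] 1, x < 1 := self_mem_nhdsWithin
  have hx0 : ∀ᶠ x : ℝ in 𝓝[<] 1, 0 < x := nhdsWithin_le_nhds (lt_mem_nhds one_pos)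
  have hL := tendsto_neg_log_one_sub
  have hA' : ∀ᶠ x : ℝ in 𝓝[<] 1, A x + t = (d : ℝ) / 2 * -Real.log (1 - x) +
      ((d : ℝ) - 2) / 2 * Real.log (-Real.log (1 - x)) +
      (d : ℝ) / 2 * Real.log ((d : ℝ) / 2) + Real.log c + t := by
    filter_upwards [hL.eventually_gt_atTop 0] with x hx
    rw [hA, hcpi, abs_of_neg (neg_pos.1 hx)]
  have hB : Tendsto (fun x => (A x + t) / -Real.log (1 - x)) (𝓝[<] 1) (𝓝 (d / 2)) := by
    refine ((tendsto_centering_div (d := d)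
      ((d : ℝ) / 2 * Real.log ((d : ℝ) / 2) + Real.log c + t)).comp hL).congr' ?_
    filter_upwards [hA'] with x hx
    rw [hx, Function.comp_apply]
    ring
  have hBtop : Tendsto (fun x => A x + t) (𝓝[<] 1) atTop := by
    refine (hB.pos_mul_atTop hd0 hL).congr' ?_
    filter_upwards [hL.eventually_gt_atTop 0] with x hx
    rw [div_mul_cancel₀ _ hx.ne']
  have hj0 : ∀ k, (0 : ℝ) ≤ jd k := fun k => Nat.cast_nonneg _
  have hS := tendsto_tsum_ite_mul_pow (K := Real.exp (-t) / (c * √((d : ℝ) / 2) ^ d)) hd hj0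
    hc0.le hC hN hB (by
      filter_upwards [hA', hx1, hL.eventually_gt_atTop 0] with x h1 h2 h3
      rw [h1, exp_neg_centering_eq hc0 hd (sub_pos.2 h2) h3])
  rw [div_mul_cancel₀ _ (by positivity)] at hS
  have hlow := (((tendsto_rpow_div_one_sub hBtop).const_add 1).inv₀ (by norm_num)).mul hS
  rw [add_zero, inv_one, one_mul] at hlow
  have hsum : ∀ᶠ x : ℝ in 𝓝[<] 1, Summable fun k => (jd k : ℝ) * x ^ k := by
    filter_upwards [hx0, hx1] with x h0 h1
    exact summable_mul_pow_of_abs_sum_sub_le hj0 hc0.le hC hN h0.le h1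
  have hlog := tendsto_of_tendsto_of_tendsto_of_le_of_le' hlow hS
    (f := fun x => ∑' k : ℕ, if (A x + t) / (1 - x) < (k : ℝ) then
      (jd k : ℝ) * Real.log (1 + x ^ k) else 0)
    (by filter_upwards [hx0, hx1, hsum] with x h0 h1 h2
        exact (tsum_ite_mul_log_bounds hj0 h0 h1 h2).1)
    (by filter_upwards [hx0, hx1, hsum] with x h0 h1 h2
        exact (tsum_ite_mul_log_bounds hj0 h0 h1 h2).2)
  refine ((Real.continuous_exp.tendsto _).comp hlog.neg).congr' ?_
  filter_upwards [hx0, hsum] with x h0 h1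
  exact (tprod_ite_one_add_pow_rpow_neg hj0 h0 h1).symm
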